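/- Let h̃₂(b, b_x) = −b³b⁵b_x² + b⁴b³b_x³ + b¹b⁵b_x⁵ − b³b⁶. Then for every smooth curve b: ℝ → ℝ⁶ with b'¹(x) ≠ 0 for all x, and for all i ∈ {1, …, 6} and all x, −Σ_{β,γ,s} φ^{βγ} ψ^i_β(b'(x)) · (d/dx)[ψ^s_γ(b'(x)) E_s(h̃₂)(x)] = w^i(b'(x)). That is, the second six-component WDVV hydrodynamic type system a_z = (w(a))_x, written in potential form b_z^i = w^i(b_x) with a = b_x, is Hamiltonian with nonlocal Hamiltonian density h̃₂ with respect to the factorised third-order Hamiltonian operator determined by Ψ and Φ. -/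

import Mathlib

open scoped BigOperators

/-- Euler–Lagrange (variational) derivative of a density `h(b, b_x)` along a curve `b`. -/
noncomputable def ELd (h : (Fin 6 → ℝ) → (Fin 6 → ℝ) → ℝ)
    (b : ℝ → Fin 6 → ℝ) (s : Fin 6) (x : ℝ) : ℝ :=
  fderiv ℝ (fun u => h u (deriv b x)) (b x) (Pi.single s 1)
  - deriv (fun y => fderiv ℝ (fun v => h (b y) v) (deriv b y) (Pi.single s 1)) x

/-- The matrix Ψ(a) = (ψ^γ_i(a)) (row index i, column index γ). -/
noncomputable def ΨW (a : Fin 6 → ℝ) : Matrix (Fin 6) (Fin 6) ℝ :=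
  !![1, a 4, a 3, 0, 0, 0;
     0, a 2, 0, 1, a 4, 0;
     0, -a 1, 0, 0, -a 3, 1;
     0, 0, -a 0, 0, a 2, 0;
     0, -a 0, 0, 0, -a 1, 0;
     0, 0, 0, 0, -1, 0]

/-- The constant symmetric matrix Φ = (φ_{βγ}). -/
noncomputable def ΦW : Matrix (Fin 6) (Fin 6) ℝ :=
  !![0, 0, 0, 0, -1, 0;
     0, 0, 0, -1, 0, 0;
     0, 0, 1, 0, 0, 1;
     0, -1, 0, 0, 0, 0;
     -1, 0, 0, 0, 0, 0;
     0, 0, 1, 0, 0, 2]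

/-- The velocity w(a) of the second six-component WDVV hydrodynamic type system. -/
noncomputable def wW (a : Fin 6 → ℝ) : Fin 6 → ℝ :=
  ![a 2, a 4, a 5, (a 2*a 3 + a 5)/a 0, (2*a 2*a 4 - a 1*a 5)/a 0,
    (a 4)^2 - a 3*a 5 + ((a 2)^2*a 3 + a 2*a 5 - 2*a 1*a 2*a 4 + (a 1)^2*a 5)/a 0]

/-- The nonlocal Hamiltonian density h̃₂ of the second WDVV hydrodynamic type system. -/
noncomputable def h2W (b bx : Fin 6 → ℝ) : ℝ :=
  -(b 2)*(b 4)*(bx 1) + (b 3)*(b 2)*(bx 2) + (b 0)*(b 4)*(bx 4) - (b 2)*(b 5)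

/-- The explicit inverse of `ΨW a` for `a 0 ≠ 0`. -/
noncomputable def ΨWInv (a : Fin 6 → ℝ) : Matrix (Fin 6) (Fin 6) ℝ :=
  !![1, 0, 0, a 3 / a 0, a 4 / a 0, (a 2 * a 3 - a 1 * a 4) / a 0;
     0, 0, 0, 0, -1 / a 0, a 1 / a 0;
     0, 0, 0, -1 / a 0, 0, -a 2 / a 0;
     0, 1, 0, 0, a 2 / a 0, a 4 - a 1 * a 2 / a 0;
     0, 0, 0, 0, 0, -1;
     0, 0, 1, 0, -a 1 / a 0, a 1 ^ 2 / a 0 - a 3]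

theorem inv_ΨW {a : Fin 6 → ℝ} (ha : a 0 ≠ 0) : (ΨW a)⁻¹ = ΨWInv a := by
  refine Matrix.inv_eq_right_inv ?_
  ext i j
  fin_cases i <;> fin_cases j <;>
    simp [ΨW, ΨWInv, Matrix.mul_apply, Fin.sum_univ_six] <;> field_simp <;> ring

theorem inv_ΦW : ΦW⁻¹ =
    !![0, 0, 0, 0, -1, 0;
       0, 0, 0, -1, 0, 0;
       0, 0, 2, 0, 0, -1;
       0, -1, 0, 0, 0, 0;
       -1, 0, 0, 0, 0, 0;
       0, 0, -1, 0, 0, 1] := by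
  refine Matrix.inv_eq_right_inv ?_
  ext i j
  fin_cases i <;> fin_cases j <;>
    simp [ΦW, Matrix.mul_apply, Fin.sum_univ_six] <;> norm_num

theorem fderiv_h2W_fst (u v : Fin 6 → ℝ) (s : Fin 6) :
    fderiv ℝ (fun u => h2W u v) u (Pi.single s 1) =
      ![u 4 * v 4, 0, -u 4 * v 1 + u 3 * v 2 - u 5, u 2 * v 2, -u 2 * v 1 + u 0 * v 4, -u 2] s := by
  have hp (i : Fin 6) := hasFDerivAt_apply (𝕜 := ℝ) (F' := fun _ => ℝ) i u
  have h : HasFDerivAt (fun u => h2W u v) _ u :=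
    ((((((hp 2).neg.mul (hp 4)).mul_const (v 1)).add
      (((hp 3).mul (hp 2)).mul_const (v 2))).add
      (((hp 0).mul (hp 4)).mul_const (v 4)))).sub ((hp 2).mul (hp 5))
  rw [h.fderiv]
  fin_cases s <;> simp <;> ring

theorem fderiv_h2W_snd (u v : Fin 6 → ℝ) (s : Fin 6) :
    fderiv ℝ (fun v => h2W u v) v (Pi.single s 1) =
      ![0, -u 2 * u 4, u 3 * u 2, 0, u 0 * u 4, 0] s := by
  have hp (i : Fin 6) := hasFDerivAt_apply (𝕜 := ℝ) (F' := fun _ => ℝ) i v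
  have h : HasFDerivAt (fun v => h2W u v) _ v :=
    ((((hp 1).const_mul (-(u 2) * (u 4))).add ((hp 2).const_mul (u 3 * u 2))).add
      ((hp 4).const_mul (u 0 * u 4))).sub_const (u 2 * u 5)
  rw [h.fderiv]
  fin_cases s <;> simp

theorem ELd_h2W {b : ℝ → Fin 6 → ℝ} {x : ℝ} (hb : DifferentiableAt ℝ b x) (s : Fin 6) :
    ELd h2W b s x =
      ![b x 4 * deriv b x 4,
        deriv b x 2 * b x 4 + b x 2 * deriv b x 4,
        -b x 4 * deriv b x 1 - b x 2 * deriv b x 3 - b x 5,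
        b x 2 * deriv b x 2,
        -b x 2 * deriv b x 1 - b x 4 * deriv b x 0,
        -b x 2] s := by
  have hd (i : Fin 6) : HasDerivAt (fun y => b y i) (deriv b x i) x :=
    hasDerivAt_pi.1 hb.hasDerivAt i
  have h24 := ((hd 2).mul (hd 4)).deriv
  have h32 := ((hd 3).mul (hd 2)).deriv
  have h04 := ((hd 0).mul (hd 4)).deriv
  simp only [Pi.mul_def] at h24 h32 h04
  simp only [ELd, fderiv_h2W_fst, fderiv_h2W_snd]
  fin_cases s <;> simp [-deriv_fun_mul, h24, h32, h04] <;> ring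

/-- The components `∑ s, ψ^s_γ(b_x) E_s(h̃₂)` are the components of `b` itself. -/
theorem sum_ΨWInv_mul_ELd {b : ℝ → Fin 6 → ℝ} {x : ℝ} (hb : DifferentiableAt ℝ b x)
    (hx : deriv b x 0 ≠ 0) (γ : Fin 6) :
    ∑ s, ΨWInv (deriv b x) γ s * ELd h2W b s x = ![0, b x 4, 0, 0, b x 2, -b x 5] γ := by
  simp only [ELd_h2W hb, Fin.sum_univ_six]
  fin_cases γ <;> simp [ΨWInv] <;> field_simp <;> ring

theorem differentiable_ΨWInv_mul_ELd {b : ℝ → Fin 6 → ℝ} (hb : Differentiable ℝ b)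
    (hb' : Differentiable ℝ (deriv b)) (hb1 : ∀ x, deriv b x 0 ≠ 0) (γ s : Fin 6) :
    Differentiable ℝ fun y => ΨWInv (deriv b y) γ s * ELd h2W b s y := by
  have hc (i : Fin 6) : Differentiable ℝ fun y => b y i := differentiable_pi.1 hb i
  have hc' (i : Fin 6) : Differentiable ℝ fun y => deriv b y i := differentiable_pi.1 hb' i
  have hE : Differentiable ℝ fun y => ELd h2W b s y := by
    simp only [ELd_h2W (hb _)]
    fin_cases s <;> simp <;> fun_prop
  have hΨ : Differentiable ℝ fun y => ΨWInv (deriv b y) γ s := by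
    fin_cases γ <;> fin_cases s <;> simp [ΨWInv] <;> fun_prop (disch := assumption)
  exact hΨ.mul hE

theorem sum_deriv_ΨWInv_mul_ELd {b : ℝ → Fin 6 → ℝ} (hb : Differentiable ℝ b)
    (hb' : Differentiable ℝ (deriv b)) (hb1 : ∀ x, deriv b x 0 ≠ 0) (γ : Fin 6) (x : ℝ) :
    ∑ s, deriv (fun y => ΨWInv (deriv b y) γ s * ELd h2W b s y) x =
      ![0, deriv b x 4, 0, 0, deriv b x 2, -deriv b x 5] γ := by
  have hd (i : Fin 6) : deriv (fun y => b y i) x = deriv b x i :=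
    (hasDerivAt_pi.1 (hb x).hasDerivAt i).deriv
  rw [← deriv_fun_sum fun s _ => differentiable_ΨWInv_mul_ELd hb hb' hb1 γ s x]
  simp only [sum_ΨWInv_mul_ELd (hb _) (hb1 _)]
  fin_cases γ <;> simp [hd]

/-- The second six-component WDVV hydrodynamic type system, in potential form
b_z^i = w^i(b_x), is Hamiltonian with density h̃₂ with respect to the factorised
third-order Hamiltonian operator determined by Ψ and Φ. -/
theorem wdvv_second_system_hamiltonian
    (b : ℝ → Fin 6 → ℝ) (hb : ContDiff ℝ (⊤ : ℕ∞) b)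
    (hb1 : ∀ x, deriv b x 0 ≠ 0) :
    ∀ (i : Fin 6) (x : ℝ),
      -(∑ β, ∑ γ, ∑ s, ΦW⁻¹ β γ * (ΨW (deriv b x))⁻¹ β i *
          deriv (fun y => (ΨW (deriv b y))⁻¹ γ s * ELd h2W b s y) x)
        = wW (deriv b x) i := by
  have hd : Differentiable ℝ b := hb.differentiable (by simp)
  have hd' : Differentiable ℝ (deriv b) :=
    (contDiff_infty_iff_deriv.1 hb).2.differentiable (by simp)
  intro i x
  have hx := hb1 x
  simp only [inv_ΨW (hb1 _), inv_ΦW, ← Finset.mul_sum,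
    sum_deriv_ΨWInv_mul_ELd hd hd' hb1]
  simp only [Fin.sum_univ_six]
  fin_cases i <;> simp [ΨWInv, wW] <;> field_simp <;> ring
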